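/- arXiv:math/9903103 — 2 statements merged into one kernel-verified Lean document; each statement's English description precedes it below -/
import Mathlib

section
/- Let (Ω, Σ, μ) be a finite measure space, X a Banach space, and f : Ω → X an RL-integrable function such that the set {(RL)∫_A f dμ : A ∈ Σ} is contained in a separable complemented subspace Y of X (i.e., Y is separable, closed, and there is a continuous linear projection P : X → X with range Y and P restricted to Y the identity). Then f has a Bochner-integrable equivalent. -/
open MeasureTheory Set Pointwise

/-- A countable partition of `A` into pairwise disjoint measurable pieces
(possibly empty, so that finite partitions are included). -/
def IsRLPartition {Ω : Type*} [MeasurableSpace Ω] (A : Set Ω) (P : ℕ → Set Ω) : Prop :=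
  (∀ i, MeasurableSet (P i)) ∧ Pairwise (Function.onFun Disjoint P) ∧ (⋃ i, P i) = A

/-- `Γ` is finer than (inscribed into) `P`: every piece of `Γ` is contained in a piece of `P`. -/
def IsFinerPartition {Ω : Type*} (Γ P : ℕ → Set Ω) : Prop :=
  ∀ j, ∃ i, Γ j ⊆ P i

/-- `T` is a choice of sampling points for the partition `P`. -/
def IsSampling {Ω : Type*} (P : ℕ → Set Ω) (T : ℕ → Ω) : Prop :=
  ∀ i, (P i).Nonempty → T i ∈ P i

/-- The RL integral sum `S(f, P, T) = ∑ᵢ μ(Pᵢ) • f(Tᵢ)`. -/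
noncomputable def RLSum {Ω X : Type*} [MeasurableSpace Ω] [NormedAddCommGroup X]
    [NormedSpace ℝ X] (μ : Measure Ω) (f : Ω → X) (P : ℕ → Set Ω) (T : ℕ → Ω) : X :=
  ∑' i, (μ (P i)).toReal • f (T i)

/-- Absolute convergence of the RL integral sum. -/
def RLSumAbsConv {Ω X : Type*} [MeasurableSpace Ω] [NormedAddCommGroup X]
    (μ : Measure Ω) (f : Ω → X) (P : ℕ → Set Ω) (T : ℕ → Ω) : Prop :=
  Summable fun i => (μ (P i)).toReal * ‖f (T i)‖

/-- `f` is RL-integrable over `A` with RL integral `x`. -/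
def HasRLIntegral {Ω X : Type*} [MeasurableSpace Ω] [NormedAddCommGroup X] [NormedSpace ℝ X]
    (μ : Measure Ω) (f : Ω → X) (A : Set Ω) (x : X) : Prop :=
  ∀ ε > 0, ∃ P : ℕ → Set Ω, IsRLPartition A P ∧
    ∀ Γ : ℕ → Set Ω, IsRLPartition A Γ → IsFinerPartition Γ P →
      ∀ T : ℕ → Ω, IsSampling Γ T →
        RLSumAbsConv μ f Γ T ∧ ‖RLSum μ f Γ T - x‖ < ε

/-- `f` has a Lebesgue-integrable majorant, i.e. `f ∈ L̄₁(Ω, Σ, μ, X)`. -/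
def HasIntegrableMajorant {Ω X : Type*} [MeasurableSpace Ω] [NormedAddCommGroup X]
    (μ : Measure Ω) (f : Ω → X) : Prop :=
  ∃ g : Ω → ℝ, Integrable g μ ∧ ∀ t, ‖f t‖ ≤ g t

/-- The limit set `I(f)`: all limit points of the net of absolute RL integral sums. -/
def RLLimitSet {Ω X : Type*} [MeasurableSpace Ω] [NormedAddCommGroup X] [NormedSpace ℝ X]
    (μ : Measure Ω) (f : Ω → X) : Set X :=
  {x | ∀ ε > 0, ∀ P : ℕ → Set Ω, IsRLPartition Set.univ P →
    ∃ Γ : ℕ → Set Ω, IsRLPartition Set.univ Γ ∧ IsFinerPartition Γ P ∧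
      ∃ T : ℕ → Ω, IsSampling Γ T ∧ RLSumAbsConv μ f Γ T ∧ ‖RLSum μ f Γ T - x‖ < ε}

/-- `g` is a Bochner-integrable equivalent of `f`: `g` is Bochner integrable and the
RL integral of `f` over every measurable set equals the Bochner integral of `g` over it. -/
def BochnerEquivalent {Ω X : Type*} [MeasurableSpace Ω] [NormedAddCommGroup X] [NormedSpace ℝ X]
    (μ : Measure Ω) (f g : Ω → X) : Prop :=
  Integrable g μ ∧ ∀ A : Set Ω, MeasurableSet A → HasRLIntegral μ f A (∫ ω in A, g ω ∂μ)

/-- `f : [0,1] → X` is Riemann integrable with Riemann integral `x`. -/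
def HasRiemannIntegral {X : Type*} [NormedAddCommGroup X] [NormedSpace ℝ X]
    (f : ℝ → X) (x : X) : Prop :=
  ∀ ε > 0, ∃ δ > 0, ∀ (n : ℕ) (a : ℕ → ℝ) (t : ℕ → ℝ),
    a 0 = 0 → a n = 1 → (∀ i < n, a i ≤ a (i + 1)) →
    (∀ i < n, a (i + 1) - a i < δ) →
    (∀ i < n, t i ∈ Set.Icc (a i) (a (i + 1))) →
    ‖(∑ i ∈ Finset.range n, (a (i + 1) - a i) • f (t i)) - x‖ < ε

namespace RLAux

open Filter Topology

variable {Ω X : Type*} [MeasurableSpace Ω]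

lemma exists_sampling [Nonempty Ω] (P : ℕ → Set Ω) : ∃ T : ℕ → Ω, IsSampling P T := by
  classical
  refine ⟨fun i => if h : (P i).Nonempty then h.some else Classical.arbitrary Ω, fun i h => ?_⟩
  simp only [h, dif_pos]
  exact h.some_mem

lemma finer_refl (P : ℕ → Set Ω) : IsFinerPartition P P := fun j => ⟨j, subset_rfl⟩

/-- near-supremum sampling -/
lemma exists_sampling_sup [Nonempty Ω] (μ : Measure Ω) (P : ℕ → Set Ω) (w : Ω → ℝ) {ε : ℝ}
    (hε : 0 < ε) (hb : ∀ i, μ (P i) ≠ 0 → ∃ C, ∀ t ∈ P i, w t ≤ C) :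
    ∃ T : ℕ → Ω, IsSampling P T ∧ ∀ i, μ (P i) ≠ 0 → ∀ t ∈ P i, w t ≤ w (T i) + ε := by
  obtain ⟨T₀, hT₀⟩ := exists_sampling P
  have key : ∀ i, ∃ s : Ω, ((P i).Nonempty → s ∈ P i) ∧
      (μ (P i) ≠ 0 → ∀ t ∈ P i, w t ≤ w s + ε) := by
    intro i
    by_cases h : μ (P i) = 0
    · exact ⟨T₀ i, hT₀ i, fun h' => absurd h h'⟩
    · have hne : (P i).Nonempty := nonempty_of_measure_ne_zero h
      obtain ⟨C, hC⟩ := hb i h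
      have hbdd : BddAbove (w '' P i) := ⟨C, by rintro _ ⟨t, ht, rfl⟩; exact hC t ht⟩
      obtain ⟨_, ⟨s, hs, rfl⟩, hlt⟩ := exists_lt_of_lt_csSup (hne.image w)
        (show sSup (w '' P i) - ε < sSup (w '' P i) by linarith)
      refine ⟨s, fun _ => hs, fun _ t ht => ?_⟩
      have := le_csSup hbdd (mem_image_of_mem w ht)
      linarith
  choose T h1 h2 using key
  exact ⟨T, h1, h2⟩

lemma step_integrable (μ : Measure Ω) [IsFiniteMeasure μ] {A : Set Ω} {P : ℕ → Set Ω}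
    (hP : IsRLPartition A P) (c : ℕ → ℝ) (hc : Summable fun i => (μ (P i)).toReal * |c i|) :
    ∃ u : Ω → ℝ, IntegrableOn u A μ ∧ ∫ ω in A, u ω ∂μ = ∑' i, (μ (P i)).toReal * c i ∧
      ∀ i, ∀ ω ∈ P i, u ω = c i := by
  classical
  obtain ⟨hm, hd, hU⟩ := hP
  let u : Ω → ℝ := fun ω => if h : ∃ i, ω ∈ P i then c h.choose else 0
  have hu : ∀ i, ∀ ω ∈ P i, u ω = c i := by
    intro i ω hω
    have h : ∃ i, ω ∈ P i := ⟨i, hω⟩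
    have : h.choose = i := by
      by_contra hne
      exact Set.disjoint_left.1 (hd hne) h.choose_spec hω
    simp only [u, h, dif_pos, this]
  have hi : ∀ i, IntegrableOn u (P i) μ := fun i =>
    (integrableOn_const (C := c i) (measure_ne_top μ _)).congr_fun
      (fun ω hω => (hu i ω hω).symm) (hm i)
  have hint : IntegrableOn u (⋃ i, P i) μ := by
    refine integrableOn_iUnion_of_summable_integral_norm hi ?_
    refine hc.congr fun i => ?_
    rw [setIntegral_congr_fun (g := fun _ => ‖c i‖) (hm i) (fun ω hω => by simp [hu i ω hω])]
    simp [Measure.real]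
  refine ⟨u, hU ▸ hint, ?_, hu⟩
  rw [← hU, integral_iUnion hm hd hint]
  refine tsum_congr fun i => ?_
  rw [setIntegral_congr_fun (g := fun _ => c i) (hm i) (fun ω hω => hu i ω hω)]
  simp [Measure.real]

lemma ae_mem (μ : Measure Ω) {A : Set Ω} {P : ℕ → Set Ω} (hA : MeasurableSet A)
    (hP : IsRLPartition A P) :
    ∀ᵐ ω ∂(μ.restrict A), ∃ i, ω ∈ P i ∧ μ (P i) ≠ 0 := by
  have h1 : ∀ᵐ ω ∂μ, ∀ i, ω ∈ P i → μ (P i) ≠ 0 := by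
    rw [ae_all_iff]
    intro i
    by_cases h : μ (P i) = 0
    · filter_upwards [measure_eq_zero_iff_ae_notMem.1 h] with ω hω hω' using absurd hω' hω
    · exact Eventually.of_forall fun _ _ => h
  filter_upwards [ae_restrict_of_ae h1, ae_restrict_mem hA] with ω h hω
  rw [← hP.2.2] at hω
  obtain ⟨i, hi⟩ := mem_iUnion.1 hω
  exact ⟨i, hi, h i hi⟩

variable [NormedAddCommGroup X] [NormedSpace ℝ X] [CompleteSpace X]

lemma summable_smul {μ : Measure Ω} {f : Ω → X} {P : ℕ → Set Ω} {T : ℕ → Ω}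
    (h : RLSumAbsConv μ f P T) : Summable fun i => (μ (P i)).toReal • f (T i) := by
  refine Summable.of_norm (h.congr fun i => ?_)
  rw [norm_smul, Real.norm_of_nonneg ENNReal.toReal_nonneg]

lemma bounded_piece [Nonempty Ω] (μ : Measure Ω) [IsFiniteMeasure μ] (f : Ω → X) {x : X} {ε : ℝ}
    {P : ℕ → Set Ω}
    (h : ∀ T : ℕ → Ω, IsSampling P T → RLSumAbsConv μ f P T ∧ ‖RLSum μ f P T - x‖ < ε)
    (i : ℕ) (hi : μ (P i) ≠ 0) : ∃ C, ∀ t ∈ P i, ‖f t‖ ≤ C := by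
  classical
  obtain ⟨T, hT⟩ := exists_sampling P
  have hpos : 0 < (μ (P i)).toReal := ENNReal.toReal_pos hi (measure_ne_top μ _)
  refine ⟨2 * ε / (μ (P i)).toReal + ‖f (T i)‖, fun t ht => ?_⟩
  have hT' : IsSampling P (Function.update T i t) := by
    intro j hj
    by_cases hji : j = i
    · subst hji; simpa using ht
    · simpa [Function.update_of_ne hji] using hT j hj
  obtain ⟨a1, b1⟩ := h T hT
  obtain ⟨a2, b2⟩ := h _ hT'
  have e : RLSum μ f P (Function.update T i t) - RLSum μ f P T
      = (μ (P i)).toReal • (f t - f (T i)) := by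
    unfold RLSum
    rw [← (summable_smul a2).tsum_sub (summable_smul a1), tsum_eq_single i]
    · simp [smul_sub]
    · intro j hj
      simp [Function.update_of_ne hj]
  have n : ‖(μ (P i)).toReal • (f t - f (T i))‖ ≤ 2 * ε := by
    rw [← e]
    calc _ = ‖(RLSum μ f P (Function.update T i t) - x) - (RLSum μ f P T - x)‖ := by
          congr 1; abel
      _ ≤ _ := (norm_sub_le _ _).trans (by linarith)
  rw [norm_smul, Real.norm_of_nonneg hpos.le] at n
  have n2 : ‖f t - f (T i)‖ ≤ 2 * ε / (μ (P i)).toReal := by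
    rw [le_div_iff₀ hpos]; linarith
  calc ‖f t‖ = ‖(f t - f (T i)) + f (T i)‖ := by simp
    _ ≤ _ := (norm_add_le _ _).trans (by linarith)

lemma summable_meas (μ : Measure Ω) [IsFiniteMeasure μ] {A : Set Ω} {P : ℕ → Set Ω}
    (hP : IsRLPartition A P) : HasSum (fun i => (μ (P i)).toReal) (μ A).toReal := by
  have h := measure_iUnion hP.2.1 hP.1 (μ := μ)
  rw [hP.2.2] at h
  have h2 : ∑' i, μ (P i) ≠ ⊤ := h ▸ measure_ne_top μ A
  rw [h, ENNReal.tsum_toReal_eq (fun i => measure_ne_top μ _)]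
  exact (ENNReal.summable_toReal h2).hasSum

/-- one-sided approximation of a scalar function -/
lemma scalar_upper [Nonempty Ω] (μ : Measure Ω) [IsFiniteMeasure μ] (w : Ω → ℝ) {A : Set Ω}
    (hA : MeasurableSet A) {r : ℝ} (h : HasRLIntegral μ w A r) {ε : ℝ} (hε : 0 < ε) :
    ∃ u : Ω → ℝ, IntegrableOn u A μ ∧ |∫ ω in A, u ω ∂μ - r| ≤ ε ∧
      ∀ᵐ ω ∂(μ.restrict A), w ω ≤ u ω := by
  set δ : ℝ := ε / (1 + (μ A).toReal) with hδ
  have hM : 0 ≤ (μ A).toReal := ENNReal.toReal_nonneg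
  have hδ0 : 0 < δ := by positivity
  have hδe : δ * (1 + (μ A).toReal) = ε := by rw [hδ]; field_simp
  obtain ⟨P, hP, hs⟩ := h δ hδ0
  have hs' := hs P hP (finer_refl P)
  obtain ⟨T, hT, hTs⟩ := exists_sampling_sup μ P w hδ0 (fun i hi => by
    obtain ⟨C, hC⟩ := bounded_piece μ w hs' i hi
    exact ⟨C, fun t ht => (le_abs_self _).trans (hC t ht)⟩)
  obtain ⟨a, b⟩ := hs' T hT
  have hm := summable_meas μ hP
  have hsum : Summable fun i => (μ (P i)).toReal * |w (T i) + δ| := by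
    refine Summable.of_nonneg_of_le (fun i => by positivity) (fun i => ?_)
      (Summable.add a (hm.summable.mul_right δ))
    rw [← mul_add]
    gcongr
    exact (abs_add_le _ _).trans (by rw [abs_of_pos hδ0, Real.norm_eq_abs])
  obtain ⟨u, hu1, hu2, hu3⟩ := step_integrable μ hP _ hsum
  refine ⟨u, hu1, ?_, ?_⟩
  · have e : ∑' i, (μ (P i)).toReal * (w (T i) + δ) = RLSum μ w P T + (μ A).toReal * δ := by
      have := ((summable_smul a).hasSum.add (hm.mul_right δ)).tsum_eq
      rw [RLSum, ← this]
      exact tsum_congr fun i => by simp [mul_add]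
    rw [hu2, e]
    rw [Real.norm_eq_abs] at b
    have b' := abs_lt.1 b
    rw [abs_le]
    constructor <;> nlinarith
  · filter_upwards [ae_mem μ hA hP] with ω ⟨i, hi, hi'⟩
    rw [hu3 i ω hi]
    exact hTs i hi' ω hi

lemma map_clm {Z : Type*} [NormedAddCommGroup Z] [NormedSpace ℝ Z] (μ : Measure Ω) {f : Ω → X}
    {A : Set Ω} {x : X} (h : HasRLIntegral μ f A x) (L : X →L[ℝ] Z) :
    HasRLIntegral μ (fun ω => L (f ω)) A (L x) := by
  intro ε hε
  have hδ : 0 < ε / (‖L‖ + 1) := by positivity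
  obtain ⟨P, hP, hs⟩ := h _ hδ
  refine ⟨P, hP, fun Γ hΓ hΓP T hT => ?_⟩
  obtain ⟨a, b⟩ := hs Γ hΓ hΓP T hT
  constructor
  · refine Summable.of_nonneg_of_le (fun i => by positivity) (fun i => ?_) (a.mul_left ‖L‖)
    rw [mul_left_comm]
    gcongr
    exact L.le_opNorm _
  · have e : RLSum μ (fun ω => L (f ω)) Γ T = L (RLSum μ f Γ T) := by
      unfold RLSum
      rw [L.map_tsum (summable_smul a)]
      simp
    rw [e, ← map_sub]
    rw [lt_div_iff₀ (by positivity)] at b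
    have := L.le_opNorm (RLSum μ f Γ T - x)
    nlinarith [norm_nonneg (RLSum μ f Γ T - x)]

lemma scalar_main [Nonempty Ω] (μ : Measure Ω) [IsFiniteMeasure μ] (w : Ω → ℝ) {A : Set Ω}
    (hA : MeasurableSet A) {r : ℝ} (h : HasRLIntegral μ w A r) :
    IntegrableOn w A μ ∧ ∫ ω in A, w ω ∂μ = r := by
  have hn : HasRLIntegral μ (fun ω => - w ω) A (-r) := by
    simpa using map_clm μ h (-(ContinuousLinearMap.id ℝ ℝ))
  have hpos : ∀ n : ℕ, (0 : ℝ) < 1 / ((n : ℝ) + 1) := fun n => by positivity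
  choose u u1 u2 u3 using fun n : ℕ => scalar_upper μ w hA h (hpos n)
  choose l l1 l2 l3 using fun n : ℕ => scalar_upper μ _ hA hn (hpos n)
  have hu3 := ae_all_iff.2 u3
  have hl3 := ae_all_iff.2 l3
  have hlim0 : Tendsto (fun n : ℕ => 1 / ((n : ℝ) + 1)) atTop (𝓝 0) :=
    tendsto_one_div_add_atTop_nhds_zero_nat
  have hTM : TendstoInMeasure (μ.restrict A) (fun n => u n + l n) atTop (fun _ => (0 : ℝ)) := by
    refine tendstoInMeasure_of_tendsto_eLpNorm (p := 1) one_ne_zero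
      (fun n => ((u1 n).add (l1 n)).aestronglyMeasurable) aestronglyMeasurable_const ?_
    have hb : ∀ n, eLpNorm ((u n + l n) - fun _ => (0 : ℝ)) 1 (μ.restrict A)
        ≤ ENNReal.ofReal (2 * (1 / ((n : ℝ) + 1))) := by
      intro n
      have : ((u n + l n) - fun _ => (0 : ℝ)) = u n + l n := by ext; simp
      rw [this, eLpNorm_one_eq_lintegral_enorm, ← ofReal_integral_norm_eq_lintegral_enorm
        ((u1 n).add (l1 n))]
      apply ENNReal.ofReal_le_ofReal
      have : ∫ ω in A, ‖(u n + l n) ω‖ ∂μ = ∫ ω in A, (u n ω + l n ω) ∂μ := by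
        refine integral_congr_ae ?_
        filter_upwards [u3 n, l3 n] with ω h1 h2
        rw [Pi.add_apply, Real.norm_of_nonneg (by linarith)]
      rw [this, integral_add (u1 n) (l1 n)]
      have e1 := abs_le.1 (u2 n)
      have e2 := abs_le.1 (l2 n)
      linarith
    refine tendsto_of_tendsto_of_tendsto_of_le_of_le tendsto_const_nhds ?_
      (fun n => zero_le) hb
    have := ENNReal.tendsto_ofReal (hlim0.const_mul 2)
    simpa using this
  obtain ⟨ns, -, hns⟩ := hTM.exists_seq_tendsto_ae
  have hmeas : AEStronglyMeasurable w (μ.restrict A) := by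
    refine aestronglyMeasurable_of_tendsto_ae atTop (f := fun i => u (ns i))
      (fun i => (u1 (ns i)).aestronglyMeasurable) ?_
    filter_upwards [hns, hu3, hl3] with ω h1 h2 h3
    refine tendsto_of_tendsto_of_tendsto_of_le_of_le (tendsto_const_nhds (x := w ω))
      (by simpa using h1.const_add (w ω)) (fun i => h2 _) (fun i => ?_)
    have := h3 (ns i)
    simp only [Pi.add_apply]
    linarith
  have hint : IntegrableOn w A μ := by
    refine Integrable.mono' ((u1 0).norm.add (l1 0).norm) hmeas ?_
    filter_upwards [u3 0, l3 0] with ω h1 h2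
    simp only [Pi.add_apply, Real.norm_eq_abs]
    rw [abs_le]
    have := le_abs_self (u 0 ω)
    have := le_abs_self (l 0 ω)
    have := abs_nonneg (u 0 ω)
    have := abs_nonneg (l 0 ω)
    constructor <;> linarith
  refine ⟨hint, ?_⟩
  have hle : ∀ n : ℕ, |∫ ω in A, w ω ∂μ - r| ≤ 1 / ((n : ℝ) + 1) := by
    intro n
    have e1 := integral_mono_ae hint (u1 n) (u3 n)
    have e2 := integral_mono_ae hint.neg (l1 n) (l3 n)
    simp only [Pi.neg_apply, integral_neg] at e2
    have e3 := abs_le.1 (u2 n)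
    have e4 := abs_le.1 (l2 n)
    rw [abs_le]
    constructor <;> linarith
  have := ge_of_tendsto' hlim0 hle
  have := abs_nonpos_iff.1 this
  linarith

lemma exists_bound [Nonempty Ω] (μ : Measure Ω) [IsFiniteMeasure μ] (f : Ω → X) {A : Set Ω}
    (hA : MeasurableSet A) {x : X} (h : HasRLIntegral μ f A x) :
    ∃ u : Ω → ℝ, IntegrableOn u A μ ∧ ∀ᵐ ω ∂(μ.restrict A), ‖f ω‖ ≤ u ω := by
  obtain ⟨P, hP, hs⟩ := h 1 one_pos
  have hs' := hs P hP (finer_refl P)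
  obtain ⟨T, hT, hTs⟩ := exists_sampling_sup μ P (fun ω => ‖f ω‖) one_pos
    (fun i hi => bounded_piece μ f hs' i hi)
  obtain ⟨a, -⟩ := hs' T hT
  have hsum : Summable fun i => (μ (P i)).toReal * |‖f (T i)‖ + 1| := by
    refine (Summable.add a (summable_meas μ hP).summable).congr fun i => ?_
    rw [abs_of_nonneg (by positivity)]; ring
  obtain ⟨u, hu1, -, hu3⟩ := step_integrable μ hP _ hsum
  refine ⟨u, hu1, ?_⟩
  filter_upwards [ae_mem μ hA hP] with ω ⟨i, hi, hi'⟩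
  rw [hu3 i ω hi]
  exact hTs i hi' ω hi

lemma inter_partition {A : Set Ω} (hA : MeasurableSet A) {P : ℕ → Set Ω}
    (hP : IsRLPartition Set.univ P) : IsRLPartition A (fun i => P i ∩ A) := by
  refine ⟨fun i => (hP.1 i).inter hA, fun i j hij => ?_, ?_⟩
  · exact (hP.2.1 hij).mono inter_subset_left inter_subset_left
  · rw [← iUnion_inter, hP.2.2, univ_inter]

lemma common_refinement {A : Set Ω} {P Q : ℕ → Set Ω} (hP : IsRLPartition A P)
    (hQ : IsRLPartition A Q) :
    ∃ R, IsRLPartition A R ∧ IsFinerPartition R P ∧ IsFinerPartition R Q := by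
  refine ⟨fun n => P n.unpair.1 ∩ Q n.unpair.2, ⟨fun n => (hP.1 _).inter (hQ.1 _), ?_, ?_⟩,
    fun n => ⟨_, inter_subset_left⟩, fun n => ⟨_, inter_subset_right⟩⟩
  · intro m n hmn
    by_cases h1 : m.unpair.1 = n.unpair.1
    · have h2 : m.unpair.2 ≠ n.unpair.2 := by
        intro h2
        apply hmn
        rw [← Nat.pair_unpair m, ← Nat.pair_unpair n, h1, h2]
      exact (hQ.2.1 h2).mono inter_subset_right inter_subset_right
    · exact (hP.2.1 h1).mono inter_subset_left inter_subset_left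
  · ext ω
    simp only [mem_iUnion, mem_inter_iff]
    constructor
    · rintro ⟨n, h, -⟩
      rw [← hP.2.2]
      exact mem_iUnion.2 ⟨_, h⟩
    · intro h
      obtain ⟨i, hi⟩ := mem_iUnion.1 (hP.2.2.symm ▸ h)
      obtain ⟨j, hj⟩ := mem_iUnion.1 (hQ.2.2.symm ▸ h)
      exact ⟨Nat.pair i j, by simpa using ⟨hi, hj⟩⟩

lemma glue (μ : Measure Ω) (f : Ω → X) {A : Set Ω} {Γ Q : ℕ → Set Ω}
    {T S : ℕ → Ω} (hΓ : IsRLPartition A Γ) (hQ : IsRLPartition Aᶜ Q) (hT : IsSampling Γ T)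
    (hS : IsSampling Q S) {P : ℕ → Set Ω} (h1 : IsFinerPartition Γ P) (h2 : IsFinerPartition Q P) :
    ∃ (G : ℕ → Set Ω) (U : ℕ → Ω), IsRLPartition Set.univ G ∧ IsFinerPartition G P ∧
      IsSampling G U ∧ (RLSumAbsConv μ f G U → RLSumAbsConv μ f Γ T ∧
        RLSum μ f G U = RLSum μ f Γ T + RLSum μ f Q S) := by
  obtain ⟨e⟩ : Nonempty (ℕ ≃ ℕ ⊕ ℕ) := ⟨Equiv.natSumNatEquivNat.symm⟩
  let G' : ℕ ⊕ ℕ → Set Ω := Sum.elim Γ Q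
  let U' : ℕ ⊕ ℕ → Ω := Sum.elim T S
  have subA : ∀ i, Γ i ⊆ A := fun i => hΓ.2.2 ▸ subset_iUnion Γ i
  have subB : ∀ i, Q i ⊆ Aᶜ := fun i => hQ.2.2 ▸ subset_iUnion Q i
  have hdis : ∀ i j, Disjoint (Γ i) (Q j) := fun i j =>
    (disjoint_compl_right (a := A)).mono (subA i) (subB j)
  have m' : ∀ k, MeasurableSet (G' k) := by
    rintro (i | i)
    · exact hΓ.1 i
    · exact hQ.1 i
  have d' : ∀ k l, k ≠ l → Disjoint (G' k) (G' l) := by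
    rintro (i | i) (j | j) hne
    · exact hΓ.2.1 (fun h => hne (by rw [h]))
    · exact hdis i j
    · exact (hdis j i).symm
    · exact hQ.2.1 (fun h => hne (by rw [h]))
  have f' : ∀ k, ∃ i, G' k ⊆ P i := by
    rintro (i | i)
    · exact h1 i
    · exact h2 i
  have s' : ∀ k, (G' k).Nonempty → U' k ∈ G' k := by
    rintro (i | i)
    · exact hT i
    · exact hS i
  refine ⟨G' ∘ e, U' ∘ e, ⟨fun n => m' _, fun m n hmn => d' _ _ (e.injective.ne hmn), ?_⟩,
    fun n => f' _, fun n => s' _, ?_⟩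
  · rw [eq_univ_iff_forall]
    intro ω
    by_cases hω : ω ∈ A
    · obtain ⟨i, hi⟩ := mem_iUnion.1 (hΓ.2.2.symm ▸ hω)
      exact mem_iUnion.2 ⟨e.symm (Sum.inl i), by simpa [G'] using hi⟩
    · have hω' : ω ∈ Aᶜ := hω
      obtain ⟨i, hi⟩ := mem_iUnion.1 (hQ.2.2.symm ▸ hω')
      exact mem_iUnion.2 ⟨e.symm (Sum.inr i), by simpa [G'] using hi⟩
  · intro ha
    have ha' : Summable (fun k => (μ (G' k)).toReal * ‖f (U' k)‖) :=
      (e.summable_iff (f := fun k => (μ (G' k)).toReal * ‖f (U' k)‖)).1 ha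
    have hl : RLSumAbsConv μ f Γ T := by
      have h0 := ha'.comp_injective (i := (Sum.inl : ℕ → ℕ ⊕ ℕ)) Sum.inl_injective
      exact h0
    have hr : RLSumAbsConv μ f Q S := by
      have h0 := ha'.comp_injective (i := (Sum.inr : ℕ → ℕ ⊕ ℕ)) Sum.inr_injective
      exact h0
    refine ⟨hl, ?_⟩
    have key := HasSum.sum (f := fun k => (μ (G' k)).toReal • f (U' k))
      (summable_smul hl).hasSum (summable_smul hr).hasSum
    exact ((e.hasSum_iff (f := fun k => (μ (G' k)).toReal • f (U' k))).2 key).tsum_eq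

lemma restrict [Nonempty Ω] (μ : Measure Ω) (f : Ω → X) {x : X}
    (h : HasRLIntegral μ f Set.univ x) {A : Set Ω} (hA : MeasurableSet A) :
    ∃ y, HasRLIntegral μ f A y := by
  -- uniform Cauchy estimate
  have key : ∀ ε > 0, ∃ P : ℕ → Set Ω, IsRLPartition A P ∧
      ∀ Γ T, IsRLPartition A Γ → IsFinerPartition Γ P → IsSampling Γ T →
        RLSumAbsConv μ f Γ T ∧ ∀ Γ' T', IsRLPartition A Γ' → IsFinerPartition Γ' P →
          IsSampling Γ' T' → ‖RLSum μ f Γ T - RLSum μ f Γ' T'‖ ≤ ε := by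
    intro ε hε
    obtain ⟨P, hP, hs⟩ := h (ε / 2) (by positivity)
    have hQ := inter_partition hA.compl hP
    obtain ⟨S, hS⟩ := exists_sampling (fun i => P i ∩ Aᶜ)
    refine ⟨fun i => P i ∩ A, inter_partition hA hP, ?_⟩
    have hfin : ∀ Γ : ℕ → Set Ω, IsFinerPartition Γ (fun i => P i ∩ A) → IsFinerPartition Γ P :=
      fun Γ hΓ j => let ⟨i, hi⟩ := hΓ j; ⟨i, hi.trans inter_subset_left⟩
    have hfQ : IsFinerPartition (fun i => P i ∩ Aᶜ) P := fun j => ⟨j, inter_subset_left⟩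
    have main : ∀ Γ T, IsRLPartition A Γ → IsFinerPartition Γ (fun i => P i ∩ A) →
        IsSampling Γ T → RLSumAbsConv μ f Γ T ∧
          ‖RLSum μ f Γ T + RLSum μ f (fun i => P i ∩ Aᶜ) S - x‖ < ε / 2 := by
      intro Γ T hΓ hf hT
      obtain ⟨G, U, g1, g2, g3, g4⟩ := glue μ f hΓ hQ hT hS (hfin Γ hf) hfQ
      obtain ⟨a, b⟩ := hs G g1 g2 U g3
      obtain ⟨c, d⟩ := g4 a
      exact ⟨c, d ▸ b⟩
    intro Γ T hΓ hf hT
    refine ⟨(main Γ T hΓ hf hT).1, fun Γ' T' hΓ' hf' hT' => ?_⟩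
    have a := (main Γ T hΓ hf hT).2
    have b := (main Γ' T' hΓ' hf' hT').2
    calc _ = ‖(RLSum μ f Γ T + RLSum μ f (fun i => P i ∩ Aᶜ) S - x) -
          (RLSum μ f Γ' T' + RLSum μ f (fun i => P i ∩ Aᶜ) S - x)‖ := by congr 1; abel
      _ ≤ _ := (norm_sub_le _ _).trans (by linarith)
  have hpos : ∀ n : ℕ, (0 : ℝ) < 1 / ((n : ℝ) + 1) := fun n => by positivity
  have hlim0 : Tendsto (fun n : ℕ => 1 / ((n : ℝ) + 1)) atTop (𝓝 0) :=
    tendsto_one_div_add_atTop_nhds_zero_nat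
  choose P hP hs using fun n : ℕ => key _ (hpos n)
  choose T hT using fun n : ℕ => exists_sampling (P n)
  have hdist : ∀ m n : ℕ, ‖RLSum μ f (P m) (T m) - RLSum μ f (P n) (T n)‖ ≤
      1 / ((m : ℝ) + 1) + 1 / ((n : ℝ) + 1) := by
    intro m n
    obtain ⟨R, hR, hR1, hR2⟩ := common_refinement (hP m) (hP n)
    obtain ⟨S, hS⟩ := exists_sampling R
    have a := (hs m (P m) (T m) (hP m) (finer_refl _) (hT m)).2 R S hR hR1 hS
    have b := (hs n R S hR hR2 hS).2 (P n) (T n) (hP n) (finer_refl _) (hT n)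
    calc _ = ‖(RLSum μ f (P m) (T m) - RLSum μ f R S) +
          (RLSum μ f R S - RLSum μ f (P n) (T n))‖ := by congr 1; abel
      _ ≤ _ := (norm_add_le _ _).trans (by linarith)
  have hC : CauchySeq (fun n => RLSum μ f (P n) (T n)) := by
    refine cauchySeq_of_le_tendsto_0 (fun n : ℕ => 2 * (1 / ((n : ℝ) + 1))) ?_
      (by simpa using hlim0.const_mul 2)
    intro n m N hn hm
    rw [dist_eq_norm]
    have e1 : 1 / ((n : ℝ) + 1) ≤ 1 / ((N : ℝ) + 1) := Nat.one_div_le_one_div hn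
    have e2 : 1 / ((m : ℝ) + 1) ≤ 1 / ((N : ℝ) + 1) := Nat.one_div_le_one_div hm
    linarith [hdist n m]
  obtain ⟨y, hy⟩ := cauchySeq_tendsto_of_complete hC
  refine ⟨y, fun ε hε => ?_⟩
  have ev1 := (Metric.tendsto_nhds.1 hy) (ε / 2) (by positivity)
  have ev2 := (Metric.tendsto_nhds.1 hlim0) (ε / 2) (by positivity)
  obtain ⟨n, hn1, hn2⟩ := (ev1.and ev2).exists
  rw [dist_eq_norm] at hn1
  rw [Real.dist_eq, sub_zero, abs_of_pos (hpos n)] at hn2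
  refine ⟨P n, hP n, fun Γ hΓ hf S hS => ?_⟩
  obtain ⟨a, b⟩ := hs n Γ S hΓ hf hS
  refine ⟨a, ?_⟩
  have b' := b (P n) (T n) (hP n) (finer_refl _) (hT n)
  calc _ = ‖(RLSum μ f Γ S - RLSum μ f (P n) (T n)) + (RLSum μ f (P n) (T n) - y)‖ := by
        congr 1; abel
    _ < _ := (norm_add_le _ _).trans_lt (by linarith)

/-- Pettis measurability for functions with values in a closed separable subspace. -/
lemma pettis (ν : Measure Ω) (g : Ω → X) (Y : Submodule ℝ X) (hYclosed : IsClosed (Y : Set X))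
    (hYsep : TopologicalSpace.IsSeparable (Y : Set X)) (hg : ∀ ω, g ω ∈ Y)
    (hw : ∀ φ : X →L[ℝ] ℝ, AEMeasurable (fun ω => φ (g ω)) ν) : AEStronglyMeasurable g ν := by
  have : TopologicalSpace.SeparableSpace Y := hYsep.separableSpace
  have : CompleteSpace Y := hYclosed.completeSpace_coe
  let _ : MeasurableSpace Y := borel Y
  have : BorelSpace Y := ⟨rfl⟩
  have : SecondCountableTopology Y := UniformSpace.secondCountable_of_separable Y
  have : PolishSpace Y := inferInstance
  have hφ := fun n : ℕ => exists_dual_vector'' ℝ ((TopologicalSpace.denseSeq Y n : Y) : X)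
  choose φ hφ1 hφ2 using hφ
  let e : Y → ℕ → ℝ := fun y n => φ n y
  have he : Continuous e := continuous_pi fun n => (φ n).continuous.comp continuous_subtype_val
  have hinj : Function.Injective e := by
    intro y z hyz
    have h0 : ∀ n, φ n ((y - z : Y) : X) = 0 := by
      intro n
      have := congrFun hyz n
      simp only [e] at this
      simp [this]
    have hd : ∀ δ > 0, ‖(y - z : Y)‖ ≤ δ := by
      intro δ hδ
      obtain ⟨n, hn⟩ := (TopologicalSpace.denseRange_denseSeq Y).exists_dist_lt (y - z)
        (half_pos hδ)
      set q := TopologicalSpace.denseSeq Y n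
      rw [dist_eq_norm] at hn
      have h1 : ‖q‖ ≤ ‖(y - z) - q‖ := by
        calc ‖q‖ = φ n (q : X) := (hφ2 n).symm
          _ = φ n ((q - (y - z) : Y) : X) := by
              have e1 : ((q - (y - z) : Y) : X) = (q : X) - ((y - z : Y) : X) := rfl
              rw [e1, map_sub, h0 n, sub_zero]
          _ ≤ ‖φ n ((q - (y - z) : Y) : X)‖ := le_abs_self _
          _ ≤ ‖φ n‖ * ‖((q - (y - z) : Y) : X)‖ := (φ n).le_opNorm _
          _ ≤ 1 * ‖((q - (y - z) : Y) : X)‖ := by gcongr; exact hφ1 n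
          _ = ‖(y - z) - q‖ := by rw [one_mul, norm_sub_rev (y - z) q]; rfl
      calc ‖y - z‖ = ‖((y - z) - q) + q‖ := by simp
        _ ≤ _ := (norm_add_le _ _).trans (by linarith)
    have : ‖y - z‖ ≤ 0 := le_of_forall_pos_le_add (fun δ hδ => by simpa using hd δ hδ)
    exact sub_eq_zero.1 (norm_le_zero_iff.1 this)
  have hemb := he.measurableEmbedding hinj
  let g' : Ω → Y := fun ω => ⟨g ω, hg ω⟩
  have hg' : AEMeasurable g' ν := by
    rw [← hemb.aemeasurable_comp_iff, aemeasurable_pi_iff]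
    exact fun n => hw (φ n)
  exact continuous_subtype_val.comp_aestronglyMeasurable hg'.aestronglyMeasurable

end RLAux

/-- If `f : Ω → X` is RL-integrable and all its RL integrals over measurable sets
lie in a separable complemented subspace `Y` of `X`, then `f` has a Bochner-integrable
equivalent. -/
theorem bochnerEquivalent_of_range_in_separable_complemented
    {Ω X : Type*} [MeasurableSpace Ω] [NormedAddCommGroup X] [NormedSpace ℝ X] [CompleteSpace X]
    (μ : Measure Ω) [IsFiniteMeasure μ] (f : Ω → X)
    (hf : ∃ x, HasRLIntegral μ f Set.univ x)
    (Y : Submodule ℝ X) (hYclosed : IsClosed (Y : Set X))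
    (hYsep : TopologicalSpace.IsSeparable (Y : Set X))
    (Proj : X →L[ℝ] X) (hrange : Set.range Proj = (Y : Set X)) (hid : ∀ y ∈ Y, Proj y = y)
    (hint : ∀ A : Set Ω, MeasurableSet A → ∀ x : X, HasRLIntegral μ f A x → x ∈ Y) :
    ∃ g : Ω → X, BochnerEquivalent μ f g := by
  classical
  rcases isEmpty_or_nonempty Ω with hΩ | hΩ
  · refine ⟨f, ?_, fun A _ ε hε => ⟨fun _ => ∅, ⟨fun _ => MeasurableSet.empty, ?_, ?_⟩, ?_⟩⟩
    · have : f = fun _ => 0 := funext fun ω => hΩ.elim ω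
      rw [this]
      exact integrable_zero _ _ _
    · intro i j _
      simp [Function.onFun]
    · ext ω
      exact hΩ.elim ω
    · intro Γ _ _ T
      exact hΩ.elim (T 0)
  obtain ⟨x, hx⟩ := hf
  have hproj : ∀ A : Set Ω, ∀ y, MeasurableSet A → HasRLIntegral μ f A y →
      HasRLIntegral μ (fun ω => Proj (f ω)) A y := by
    intro A y hA hy
    have := RLAux.map_clm μ hy Proj
    rwa [hid y (hint A hA y hy)] at this
  have hscal : ∀ A : Set Ω, ∀ y, MeasurableSet A → HasRLIntegral μ f A y → ∀ φ : X →L[ℝ] ℝ,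
      IntegrableOn (fun ω => φ (Proj (f ω))) A μ ∧ ∫ ω in A, φ (Proj (f ω)) ∂μ = φ y :=
    fun A y hA hy φ => RLAux.scalar_main μ _ hA (RLAux.map_clm μ (hproj A y hA hy) φ)
  have hmeas : AEStronglyMeasurable (fun ω => Proj (f ω)) μ := by
    refine RLAux.pettis μ _ Y hYclosed hYsep (fun ω => ?_) (fun φ => ?_)
    · have : Proj (f ω) ∈ (Y : Set X) := hrange ▸ mem_range_self _
      exact this
    · have := (hscal univ x MeasurableSet.univ hx φ).1
      rw [integrableOn_univ] at this
      exact this.aemeasurable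
  have hI : Integrable (fun ω => Proj (f ω)) μ := by
    obtain ⟨u, hu1, hu2⟩ := RLAux.exists_bound μ _ MeasurableSet.univ
      (hproj univ x MeasurableSet.univ hx)
    rw [integrableOn_univ] at hu1
    rw [Measure.restrict_univ] at hu2
    exact hu1.mono' hmeas hu2
  refine ⟨fun ω => Proj (f ω), hI, fun A hA => ?_⟩
  obtain ⟨y, hy⟩ := RLAux.restrict μ f hx hA
  have : ∫ ω in A, Proj (f ω) ∂μ = y := by
    refine (SeparatingDual.eq_iff_forall_dual_eq (R := ℝ)).2 fun φ => ?_
    rw [← (hscal A y hA hy φ).2]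
    exact (φ.integral_comp_comm hI.integrableOn).symm
  rw [this]
  exact hy
end

section
/- Let X be a Banach space with the property that every separable closed subspace of X is contained in a separable complemented subspace of X. Then for every finite measure space (Ω, Σ, μ), every RL-integrable function f : Ω → X has a Bochner-integrable equivalent. -/
open MeasureTheory Set Pointwise

open scoped ENNReal

lemma rl_exists_idx {Ω : Type*} [MeasurableSpace Ω] {P : ℕ → Set Ω}
    (hP : IsRLPartition Set.univ P) :
    ∃ idx : Ω → ℕ, Measurable idx ∧ (∀ ω, ω ∈ P (idx ω)) ∧ ∀ i ω, ω ∈ P i → idx ω = i := by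
  obtain ⟨hm, hd, hu⟩ := hP
  have h : ∀ ω, ∃ i, ω ∈ P i := fun ω => by
    have : ω ∈ ⋃ i, P i := by rw [hu]; trivial
    simpa using this
  choose idx hidx using h
  have huniq : ∀ i ω, ω ∈ P i → idx ω = i := by
    intro i ω hω
    by_contra hne
    exact Set.disjoint_left.1 (hd hne) (hidx ω) hω
  refine ⟨idx, ?_, hidx, huniq⟩
  refine measurable_to_countable' fun i => ?_
  have : idx ⁻¹' {i} = P i := by
    ext ω
    constructor
    · intro h
      have h' : idx ω = i := h
      exact h' ▸ hidx ω
    · intro h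
      exact huniq i ω h
  rw [this]
  exact hm i

lemma rl_lintegral_idx {Ω : Type*} [MeasurableSpace Ω] (μ : Measure Ω) {P : ℕ → Set Ω}
    (hP : IsRLPartition Set.univ P) (idx : Ω → ℕ)
    (hidx : ∀ i ω, ω ∈ P i → idx ω = i) (F : ℕ → ℝ≥0∞) :
    ∫⁻ ω, F (idx ω) ∂μ = ∑' i, μ (P i) * F i := by
  obtain ⟨hm, hd, hu⟩ := hP
  rw [← setLIntegral_univ, ← hu, lintegral_iUnion hm hd]
  congr 1
  ext i
  rw [setLIntegral_congr_fun (hm i) (g := fun _ => F i) (fun ω hω => by simp [hidx i ω hω])]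
  simp [mul_comm]

lemma rl_tsum_iSup_le {α : Type*} (a : ℕ → α → ℝ≥0∞) (C : ℝ≥0∞)
    (h : ∀ T : ℕ → α, ∑' i, a i (T i) ≤ C) [Nonempty α] : ∑' i, ⨆ t, a i t ≤ C := by
  classical
  have h1 : ∀ i, ⨆ t, a i t = ⨆ T : ℕ → α, a i (T i) := by
    intro i
    apply le_antisymm
    · exact iSup_le fun t => le_iSup (fun T : ℕ → α => a i (T i)) (fun _ => t)
    · exact iSup_le fun T => le_iSup (fun t => a i t) (T i)
  simp_rw [h1]
  refine ENNReal.tsum_le_of_sum_range_le fun n => ?_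
  rw [ENNReal.finsetSum_iSup]
  · exact iSup_le fun T => (ENNReal.sum_le_tsum _).trans (h T)
  · intro T T'
    refine ⟨fun i => if a i (T i) ≤ a i (T' i) then T' i else T i, fun i => ?_⟩
    dsimp only
    split_ifs with hh
    · exact ⟨hh, le_rfl⟩
    · exact ⟨le_rfl, (not_le.1 hh).le⟩

/-- Width (oscillation) of a real function on a set. -/
noncomputable def rlW {Ω : Type*} (u : Ω → ℝ) (A : Set Ω) : ℝ≥0∞ :=
  ⨆ s ∈ A, ⨆ t ∈ A, ‖u s - u t‖ₑ

lemma le_rlW {Ω : Type*} (u : Ω → ℝ) {A : Set Ω} {s t : Ω} (hs : s ∈ A) (ht : t ∈ A) :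
    ‖u s - u t‖ₑ ≤ rlW u A :=
  (le_iSup₂ (f := fun t (_ : t ∈ A) => ‖u s - u t‖ₑ) t ht).trans
    (le_iSup₂ (f := fun s (_ : s ∈ A) => ⨆ t ∈ A, ‖u s - u t‖ₑ) s hs)

/-- `P` is an `ε`-good partition for `f`. -/
def RLGood {Ω X : Type*} [MeasurableSpace Ω] [NormedAddCommGroup X] [NormedSpace ℝ X]
    (μ : Measure Ω) (f : Ω → X) (x : X) (ε : ℝ) (P : ℕ → Set Ω) : Prop :=
  IsRLPartition Set.univ P ∧
      ∀ T : ℕ → Ω, IsSampling P T → RLSumAbsConv μ f P T ∧ ‖RLSum μ f P T - x‖ < ε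

lemma rl_exists_sampling {Ω : Type*} [Nonempty Ω] (P : ℕ → Set Ω) : ∃ T, IsSampling P T := by
  have : ∀ i, ∃ t, (P i).Nonempty → t ∈ P i := by
    intro i
    by_cases h : (P i).Nonempty
    · exact ⟨h.some, fun _ => h.some_mem⟩
    · exact ⟨Classical.arbitrary Ω, fun h' => (h h').elim⟩
  choose T hT using this
  exact ⟨T, hT⟩

lemma rl_osc {Ω X : Type*} [MeasurableSpace Ω] [NormedAddCommGroup X] [NormedSpace ℝ X]
    [CompleteSpace X] [Nonempty Ω] {μ : Measure Ω} [IsFiniteMeasure μ] {f : Ω → X} {x : X} {ε : ℝ}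
    {P : ℕ → Set Ω} (hP : RLGood μ f x ε P) (φ : X →L[ℝ] ℝ) :
    ∑' i, μ (P i) * rlW (fun ω => φ (f ω)) (P i) ≤ ENNReal.ofReal (‖φ‖ * (2 * ε)) := by
  classical
  obtain ⟨hpart, hgood⟩ := hP
  obtain ⟨T0, hT0⟩ := rl_exists_sampling P
  have key := rl_tsum_iSup_le (α := Ω × Ω)
    (fun i p => if p.1 ∈ P i ∧ p.2 ∈ P i then μ (P i) * ‖φ (f p.1) - φ (f p.2)‖ₑ else 0)
    (ENNReal.ofReal (‖φ‖ * (2 * ε))) ?_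
  · refine le_trans (ENNReal.tsum_le_tsum fun i => ?_) key
    simp only [rlW, ENNReal.mul_iSup]
    refine iSup₂_le fun s hs => iSup₂_le fun t ht => ?_
    refine le_trans ?_ (le_iSup _ (s, t))
    simp [hs, ht]
  · intro T
    have hex : ∀ i, ∃ p : Ω × Ω, ((P i).Nonempty → p.1 ∈ P i) ∧ ((P i).Nonempty → p.2 ∈ P i) ∧
        φ (f p.2) ≤ φ (f p.1) ∧
        (if (T i).1 ∈ P i ∧ (T i).2 ∈ P i then
          μ (P i) * ‖φ (f (T i).1) - φ (f (T i).2)‖ₑ else 0) ≤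
          ENNReal.ofReal ((μ (P i)).toReal * (φ (f p.1) - φ (f p.2))) := by
      intro i
      have hconv : ∀ a b : ℝ, b ≤ a → μ (P i) * ‖a - b‖ₑ =
          ENNReal.ofReal ((μ (P i)).toReal * (a - b)) := by
        intro a b hab
        rw [ENNReal.ofReal_mul ENNReal.toReal_nonneg, ENNReal.ofReal_toReal (measure_ne_top _ _),
          Real.enorm_eq_ofReal (sub_nonneg.2 hab)]
      by_cases h : (T i).1 ∈ P i ∧ (T i).2 ∈ P i
      · rcases le_total (φ (f (T i).2)) (φ (f (T i).1)) with h1 | h1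
        · refine ⟨T i, fun _ => h.1, fun _ => h.2, h1, ?_⟩
          rw [if_pos h, hconv _ _ h1]
        · refine ⟨((T i).2, (T i).1), fun _ => h.2, fun _ => h.1, h1, ?_⟩
          rw [if_pos h, ← hconv _ _ h1, ← enorm_neg, neg_sub]
      · refine ⟨(T0 i, T0 i), hT0 i, hT0 i, le_rfl, ?_⟩
        rw [if_neg h]; exact zero_le
    choose p hp1 hp2 hle hbd using hex
    obtain ⟨ha, hb⟩ := hgood (fun i => (p i).1) hp1
    obtain ⟨ha', hb'⟩ := hgood (fun i => (p i).2) hp2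
    have hs : ∀ t : ℕ → Ω, RLSumAbsConv μ f P t →
        HasSum (fun i => (μ (P i)).toReal * φ (f (t i))) (φ (RLSum μ f P t)) := by
      intro t ht
      have h1 : Summable fun i => (μ (P i)).toReal • f (t i) := by
        refine Summable.of_norm ?_
        simpa [RLSumAbsConv, norm_smul] using ht
      simpa [RLSum] using h1.hasSum.mapL φ
    have h3 := (hs _ ha).sub (hs _ ha')
    simp_rw [← mul_sub] at h3
    refine (ENNReal.tsum_le_tsum hbd).trans ?_
    rw [← ENNReal.ofReal_tsum_of_nonneg
      (fun i => mul_nonneg ENNReal.toReal_nonneg (sub_nonneg.2 (hle i))) h3.summable, h3.tsum_eq]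
    refine ENNReal.ofReal_le_ofReal ?_
    rw [← map_sub]
    refine (le_abs_self _).trans ((φ.le_opNorm _).trans ?_)
    gcongr
    calc _ = ‖(RLSum μ f P (fun i => (p i).1) - x) - (RLSum μ f P (fun i => (p i).2) - x)‖ := by
            congr 1; abel
      _ ≤ _ := norm_sub_le _ _
      _ ≤ _ := by linarith

lemma rl_sup {Ω X : Type*} [MeasurableSpace Ω] [NormedAddCommGroup X] [NormedSpace ℝ X]
    [CompleteSpace X] [Nonempty Ω] {μ : Measure Ω} [IsFiniteMeasure μ] {f : Ω → X} {x : X} {ε : ℝ}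
    {P : ℕ → Set Ω} (hP : RLGood μ f x ε P) :
    ∑' i, μ (P i) * (⨆ t ∈ P i, ‖f t‖ₑ) ≠ ∞ := by
  have hfin : ∀ i, μ (P i) ≠ 0 → (⨆ t ∈ P i, ‖f t‖ₑ) ≠ ∞ := by
    intro i hi
    obtain ⟨t0, ht0⟩ : (P i).Nonempty := nonempty_of_measure_ne_zero hi
    have hb : (⨆ t ∈ P i, ‖f t‖ₑ) ≤ ‖f t0‖ₑ + ENNReal.ofReal (1 * (2 * |ε|)) / μ (P i) := by
      refine iSup₂_le fun t ht => ?_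
      obtain ⟨φ, hφ, hφ'⟩ := exists_dual_vector'' ℝ (f t - f t0)
      have h1 := (ENNReal.le_tsum i).trans (rl_osc hP φ)
      have h2 : ‖f t - f t0‖ₑ ≤ ENNReal.ofReal (1 * (2 * |ε|)) / μ (P i) := by
        rw [ENNReal.le_div_iff_mul_le (Or.inl hi) (Or.inl (measure_ne_top _ _)), mul_comm]
        have h3 : ‖f t - f t0‖ₑ ≤ rlW (fun ω => φ (f ω)) (P i) := by
          refine le_trans ?_ (le_rlW _ ht ht0)
          rw [← map_sub, hφ']
          simp
        refine le_trans (by gcongr) (h1.trans (ENNReal.ofReal_le_ofReal ?_))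
        have := le_abs_self ε
        have := abs_nonneg ε
        nlinarith [norm_nonneg φ]
      calc ‖f t‖ₑ = ‖f t0 + (f t - f t0)‖ₑ := by congr 1; abel
        _ ≤ _ := enorm_add_le _ _
        _ ≤ _ := by gcongr
    refine ne_top_of_le_ne_top ?_ hb
    refine ENNReal.add_ne_top.2 ⟨enorm_ne_top, ENNReal.div_ne_top ENNReal.ofReal_ne_top hi⟩
  have hex : ∀ i, ∃ t, ((P i).Nonempty → t ∈ P i) ∧
      μ (P i) * (⨆ t ∈ P i, ‖f t‖ₑ) ≤ 2 * (μ (P i) * ‖f t‖ₑ) := by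
    intro i
    by_cases hi : μ (P i) = 0
    · obtain ⟨T0, hT0⟩ := rl_exists_sampling P
      exact ⟨T0 i, hT0 i, by simp [hi]⟩
    · obtain ⟨t0, ht0⟩ : (P i).Nonempty := nonempty_of_measure_ne_zero hi
      by_cases h0 : (⨆ t ∈ P i, ‖f t‖ₑ) = 0
      · exact ⟨t0, fun _ => ht0, by simp [h0]⟩
      · have hlt := ENNReal.half_lt_self h0 (hfin i hi)
        rw [lt_iSup_iff] at hlt
        obtain ⟨t, hlt⟩ := hlt
        rw [lt_iSup_iff] at hlt
        obtain ⟨ht, hlt⟩ := hlt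
        refine ⟨t, fun _ => ht, ?_⟩
        calc μ (P i) * (⨆ t ∈ P i, ‖f t‖ₑ) = 2 * (μ (P i) * ((⨆ t ∈ P i, ‖f t‖ₑ) / 2)) := by
              rw [mul_left_comm, ENNReal.mul_div_cancel (by simp) (by simp)]
          _ ≤ _ := by gcongr
  choose T hT hbd using hex
  have hs := (hP.2 T hT).1
  refine ne_top_of_le_ne_top ?_ (ENNReal.tsum_le_tsum hbd)
  rw [ENNReal.tsum_mul_left]
  refine ENNReal.mul_ne_top (by simp) ?_
  have : ∀ i, μ (P i) * ‖f (T i)‖ₑ = ENNReal.ofReal ((μ (P i)).toReal * ‖f (T i)‖) := by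
    intro i
    rw [ENNReal.ofReal_mul ENNReal.toReal_nonneg, ENNReal.ofReal_toReal (measure_ne_top _ _),
      ofReal_norm]
  simp_rw [this]
  exact hs.tsum_ofReal_ne_top

lemma rl_aemeasurable {Ω : Type*} [MeasurableSpace Ω] [Nonempty Ω] {μ : Measure Ω} {u : Ω → ℝ}
    (h : ∀ ε : ℝ≥0∞, ε ≠ 0 → ∃ P, IsRLPartition Set.univ P ∧ ∑' i, μ (P i) * rlW u (P i) ≤ ε) :
    AEMeasurable u μ := by
  have hε : ∀ n : ℕ, ((2 : ℝ≥0∞)⁻¹ ^ n) ≠ 0 := fun n => pow_ne_zero _ (by simp)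
  choose P hpart hW using fun n : ℕ => h _ (hε n)
  choose idx hmeas hmem huniq using fun n => rl_exists_idx (hpart n)
  choose T hT using fun n => rl_exists_sampling (P n)
  have hint : ∑' n, ∫⁻ ω, rlW u (P n (idx n ω)) ∂μ ≠ ∞ := by
    refine ne_top_of_le_ne_top ?_ (ENNReal.tsum_le_tsum (g := fun n => (2 : ℝ≥0∞)⁻¹ ^ n) fun n => ?_)
    · rw [ENNReal.tsum_geometric]
      simp
    · rw [rl_lintegral_idx μ (hpart n) (idx n) (huniq n) (fun i => rlW u (P n i))]
      exact hW n
  have hwm : ∀ n, Measurable fun ω => rlW u (P n (idx n ω)) := fun n =>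
    (measurable_from_nat (f := fun i => rlW u (P n i))).comp (hmeas n)
  rw [← lintegral_tsum (fun n => (hwm n).aemeasurable)] at hint
  have hae := ae_lt_top (Measurable.tsum hwm) hint
  refine aemeasurable_of_tendsto_metrizable_ae Filter.atTop
    (f := fun n ω => u (T n (idx n ω))) (fun n => ?_) ?_
  · exact ((measurable_from_nat (f := fun i => u (T n i))).comp (hmeas n)).aemeasurable
  · filter_upwards [hae] with ω hω
    have h0 := ENNReal.tendsto_atTop_zero_of_tsum_ne_top hω.ne
    rw [tendsto_iff_edist_tendsto_0]
    refine tendsto_of_tendsto_of_tendsto_of_le_of_le tendsto_const_nhds h0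
      (fun n => zero_le) (fun n => ?_)
    rw [edist_eq_enorm_sub]
    exact le_rlW u (hT n _ ⟨ω, hmem n ω⟩) (hmem n ω)

lemma rl_countable_separating {E : Type*} [NormedAddCommGroup E] [NormedSpace ℝ E]
    [TopologicalSpace.SeparableSpace E] :
    ∃ φ : ℕ → (E →L[ℝ] ℝ), Function.Injective fun (y : E) (n : ℕ) => φ n y := by
  choose φ hφ hφ' using fun n => exists_dual_vector'' ℝ (TopologicalSpace.denseSeq E n)
  refine ⟨φ, fun y z hyz => ?_⟩
  by_contra hne
  have hpos : 0 < ‖y - z‖ := norm_pos_iff.2 (sub_ne_zero.2 hne)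
  obtain ⟨n, hn⟩ := (TopologicalSpace.denseRange_denseSeq E).exists_dist_lt (y - z)
    (ε := ‖y - z‖ / 3) (by positivity)
  set d := TopologicalSpace.denseSeq E n with hd
  have h0 : φ n (y - z) = 0 := by
    rw [map_sub, sub_eq_zero]
    exact congrFun hyz n
  rw [dist_eq_norm] at hn
  have h1 : ‖d‖ ≤ ‖y - z - d‖ := by
    calc ‖d‖ = φ n d := (hφ' n).symm
      _ = - φ n (y - z - d) := by rw [map_sub _ (y - z), h0]; ring
      _ ≤ ‖φ n (y - z - d)‖ := neg_le_abs _
      _ ≤ ‖φ n‖ * ‖y - z - d‖ := (φ n).le_opNorm _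
      _ ≤ 1 * ‖y - z - d‖ := by gcongr; exact hφ n
      _ = _ := one_mul _
  have h2 : ‖y - z‖ ≤ ‖y - z - d‖ + ‖d‖ := by
    simpa using norm_add_le (y - z - d) d
  linarith

lemma rl_pettis {Ω E : Type*} [MeasurableSpace Ω] {μ : Measure Ω} [NormedAddCommGroup E]
    [NormedSpace ℝ E] [CompleteSpace E] [TopologicalSpace.SeparableSpace E] {h : Ω → E}
    (hw : ∀ φ : E →L[ℝ] ℝ, AEMeasurable (fun ω => φ (h ω)) μ) : AEStronglyMeasurable h μ := by
  borelize E
  obtain ⟨φ, hφ⟩ := rl_countable_separating (E := E)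
  have : SecondCountableTopology E := UniformSpace.secondCountable_of_separable E
  have hemb : MeasurableEmbedding fun (y : E) (n : ℕ) => φ n y :=
    Continuous.measurableEmbedding (continuous_pi fun n => (φ n).continuous) hφ
  have : AEMeasurable h μ := by
    rw [← hemb.aemeasurable_comp_iff]
    exact aemeasurable_pi_lambda _ fun n => hw (φ n)
  exact this.aestronglyMeasurable

lemma rl_integral_compare {Ω : Type*} [MeasurableSpace Ω] {μ : Measure Ω} [IsFiniteMeasure μ]
    {u : Ω → ℝ} (hu : Integrable u μ) {A : Set Ω} {Γ : ℕ → Set Ω} (hΓ : IsRLPartition A Γ)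
    (T : ℕ → Ω) (w : Ω → ℝ≥0∞) (hw : ∀ j, ∀ ω ∈ Γ j, ‖u (T j) - u ω‖ₑ ≤ w ω)
    (hs : Summable fun j => (μ (Γ j)).toReal * u (T j)) {C : ℝ} (hC : 0 ≤ C)
    (hwC : ∫⁻ ω, w ω ∂μ ≤ ENNReal.ofReal C) :
    |∑' j, (μ (Γ j)).toReal * u (T j) - ∫ ω in A, u ω ∂μ| ≤ C := by
  obtain ⟨hm, hd, hU⟩ := hΓ
  have h1 : HasSum (fun j => ∫ ω in Γ j, u ω ∂μ) (∫ ω in A, u ω ∂μ) := by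
    rw [← hU]
    exact hasSum_integral_iUnion hm hd hu.integrableOn
  have h2 := hs.hasSum.sub h1
  rw [← h2.tsum_eq, ← Real.norm_eq_abs, ← ENNReal.ofReal_le_ofReal_iff hC, ofReal_norm]
  refine enorm_tsum_le_tsum_enorm.trans (le_trans ?_ hwC)
  calc ∑' j, ‖(μ (Γ j)).toReal * u (T j) - ∫ ω in Γ j, u ω ∂μ‖ₑ
      ≤ ∑' j, ∫⁻ ω in Γ j, w ω ∂μ := by
        refine ENNReal.tsum_le_tsum fun j => ?_
        have : (μ (Γ j)).toReal * u (T j) - ∫ ω in Γ j, u ω ∂μ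
            = ∫ ω in Γ j, (u (T j) - u ω) ∂μ := by
          rw [integral_sub (integrable_const _) hu.integrableOn]
          simp [Measure.real]
        rw [this]
        refine (enorm_integral_le_lintegral_enorm _).trans ?_
        exact setLIntegral_mono' (hm j) (hw j)
    _ = ∫⁻ ω in A, w ω ∂μ := by rw [← hU, lintegral_iUnion hm hd]
    _ ≤ _ := setLIntegral_le_lintegral _ _

lemma rl_absConv {Ω X : Type*} [MeasurableSpace Ω] [NormedAddCommGroup X] [NormedSpace ℝ X]
    [CompleteSpace X] [Nonempty Ω] {μ : Measure Ω} [IsFiniteMeasure μ] {f : Ω → X} {x : X} {ε : ℝ}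
    {P : ℕ → Set Ω} (hP : RLGood μ f x ε P) {A : Set Ω} {Γ : ℕ → Set Ω} (hΓ : IsRLPartition A Γ)
    (T : ℕ → Ω) (hT : ∀ j, ∀ i, ∀ ω ∈ Γ j, ω ∈ P i → T j ∈ P i) : RLSumAbsConv μ f Γ T := by
  obtain ⟨idx, hmeas, hmem, huniq⟩ := rl_exists_idx hP.1
  obtain ⟨hm, hd, hU⟩ := hΓ
  have hfin := rl_sup hP
  rw [← rl_lintegral_idx μ hP.1 idx huniq (fun i => ⨆ t ∈ P i, ‖f t‖ₑ)] at hfin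
  have hne : ∑' j, μ (Γ j) * ‖f (T j)‖ₑ ≠ ∞ := by
    refine ne_top_of_le_ne_top hfin ?_
    calc ∑' j, μ (Γ j) * ‖f (T j)‖ₑ
        ≤ ∑' j, ∫⁻ ω in Γ j, (⨆ t ∈ P (idx ω), ‖f t‖ₑ) ∂μ := by
          refine ENNReal.tsum_le_tsum fun j => ?_
          calc μ (Γ j) * ‖f (T j)‖ₑ = ∫⁻ ω in Γ j, ‖f (T j)‖ₑ ∂μ := by simp [mul_comm]
            _ ≤ _ := setLIntegral_mono' (hm j) fun ω hω =>
              le_iSup₂ (f := fun t (_ : t ∈ P (idx ω)) => ‖f t‖ₑ) (T j) (hT j _ ω hω (hmem ω))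
      _ = ∫⁻ ω in A, (⨆ t ∈ P (idx ω), ‖f t‖ₑ) ∂μ := by rw [← hU, lintegral_iUnion hm hd]
      _ ≤ _ := setLIntegral_le_lintegral _ _
  have := ENNReal.summable_toReal hne
  simpa [RLSumAbsConv] using this

lemma rl_compare {Ω X : Type*} [MeasurableSpace Ω] [NormedAddCommGroup X] [NormedSpace ℝ X]
    [CompleteSpace X] [Nonempty Ω] {μ : Measure Ω} [IsFiniteMeasure μ] {f : Ω → X} {x : X} {ε : ℝ}
    (hε : 0 < ε)
    {P : ℕ → Set Ω} (hP : RLGood μ f x ε P) {A : Set Ω} {Γ : ℕ → Set Ω} (hΓ : IsRLPartition A Γ)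
    (T : ℕ → Ω) (hT : ∀ j, ∀ i, ∀ ω ∈ Γ j, ω ∈ P i → T j ∈ P i) (φ : X →L[ℝ] ℝ)
    (hu : Integrable (fun ω => φ (f ω)) μ) :
    |φ (RLSum μ f Γ T) - ∫ ω in A, φ (f ω) ∂μ| ≤ ‖φ‖ * (2 * ε) := by
  obtain ⟨idx, hmeas, hmem, huniq⟩ := rl_exists_idx hP.1
  have habs := rl_absConv hP hΓ T hT
  have hsum : HasSum (fun i => (μ (Γ i)).toReal * φ (f (T i))) (φ (RLSum μ f Γ T)) := by
    have h1 : Summable fun i => (μ (Γ i)).toReal • f (T i) := by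
      refine Summable.of_norm ?_
      simpa [RLSumAbsConv, norm_smul] using habs
    simpa [RLSum] using h1.hasSum.mapL φ
  rw [← hsum.tsum_eq]
  refine rl_integral_compare hu hΓ T (fun ω => rlW (fun ω => φ (f ω)) (P (idx ω))) ?_
    hsum.summable (by positivity) ?_
  · intro j ω hω
    exact le_rlW (fun ω => φ (f ω)) (hT j _ ω hω (hmem ω)) (hmem ω)
  · rw [rl_lintegral_idx μ hP.1 idx huniq (fun i => rlW (fun ω => φ (f ω)) (P i))]
    exact rl_osc hP φ

lemma rl_norm_lintegral {Ω X : Type*} [MeasurableSpace Ω] [NormedAddCommGroup X] [NormedSpace ℝ X]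
    [CompleteSpace X] [Nonempty Ω] {μ : Measure Ω} [IsFiniteMeasure μ] {f : Ω → X} {x : X} {ε : ℝ}
    {P : ℕ → Set Ω} (hP : RLGood μ f x ε P) {E : Type*} [NormedAddCommGroup E] [NormedSpace ℝ E]
    (L : X →L[ℝ] E) (hL : AEStronglyMeasurable (fun ω => L (f ω)) μ) :
    Integrable (fun ω => L (f ω)) μ := by
  obtain ⟨idx, hmeas, hmem, huniq⟩ := rl_exists_idx hP.1
  have hfin := rl_sup hP
  rw [← rl_lintegral_idx μ hP.1 idx huniq (fun i => ⨆ t ∈ P i, ‖f t‖ₑ)] at hfin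
  refine ⟨hL, ?_⟩
  rw [hasFiniteIntegral_iff_enorm]
  calc ∫⁻ ω, ‖L (f ω)‖ₑ ∂μ ≤ ∫⁻ ω, ‖L‖ₑ * (⨆ t ∈ P (idx ω), ‖f t‖ₑ) ∂μ := by
        refine lintegral_mono fun ω => (L.le_opENorm _).trans ?_
        gcongr
        exact le_iSup₂ (f := fun t (_ : t ∈ P (idx ω)) => ‖f t‖ₑ) ω (hmem ω)
    _ = ‖L‖ₑ * ∫⁻ ω, (⨆ t ∈ P (idx ω), ‖f t‖ₑ) ∂μ :=
        lintegral_const_mul' _ _ enorm_ne_top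
    _ < ∞ := ENNReal.mul_lt_top enorm_lt_top hfin.lt_top

/-- If every separable closed subspace of `X` is contained in a separable
complemented subspace of `X`, then for every finite measure space, every RL-integrable
`X`-valued function has a Bochner-integrable equivalent. -/
theorem bochnerEquivalent_of_separable_complementation
    {X : Type*} [NormedAddCommGroup X] [NormedSpace ℝ X] [CompleteSpace X]
    (hX : ∀ Z : Submodule ℝ X, IsClosed (Z : Set X) →
      TopologicalSpace.IsSeparable (Z : Set X) →
      ∃ Y : Submodule ℝ X, IsClosed (Y : Set X) ∧ TopologicalSpace.IsSeparable (Y : Set X) ∧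
        Z ≤ Y ∧ ∃ Proj : X →L[ℝ] X, Set.range Proj = (Y : Set X) ∧ ∀ y ∈ Y, Proj y = y) :
    ∀ (Ω : Type) (_ : MeasurableSpace Ω) (μ : Measure Ω), IsFiniteMeasure μ →
      ∀ f : Ω → X, (∃ x, HasRLIntegral μ f Set.univ x) →
        ∃ g : Ω → X, BochnerEquivalent μ f g := by
  intro Ω _ μ _ f ⟨x, hx⟩
  rcases isEmpty_or_nonempty Ω with hΩ | hΩ
  · refine ⟨0, integrable_zero _ _ _, fun A hA ε hε => ⟨fun i => if i = 0 then A else ∅, ?_, ?_⟩⟩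
    · refine ⟨fun i => ?_, fun i j _ => ?_, ?_⟩
      · dsimp only; split_ifs; exacts [hA, MeasurableSet.empty]
      · exact Set.disjoint_left.2 fun ω => (IsEmpty.false ω).elim
      · ext ω; exact (IsEmpty.false ω).elim
    · intro Γ _ _ T
      exact (IsEmpty.false (T 0)).elim
  have hgood : ∀ n : ℕ, ∃ P, RLGood μ f x (1 / ((n : ℝ) + 1)) P := by
    intro n
    obtain ⟨P, hP, hP'⟩ := hx (1 / ((n : ℝ) + 1)) (by positivity)
    exact ⟨P, hP, fun T hT => hP' P hP (fun j => ⟨j, subset_rfl⟩) T hT⟩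
  choose P hP using hgood
  choose T hT using fun n => rl_exists_sampling (P n)
  -- scalar measurability and integrability
  have hmeas : ∀ φ : X →L[ℝ] ℝ, AEMeasurable (fun ω => φ (f ω)) μ := by
    intro φ
    refine rl_aemeasurable fun ε hε => ?_
    have hlim : Filter.Tendsto (fun n : ℕ => ENNReal.ofReal (‖φ‖ * (2 * (1 / ((n : ℝ) + 1)))))
        Filter.atTop (nhds 0) := by
      have h1 : Filter.Tendsto (fun n : ℕ => ‖φ‖ * (2 * (1 / ((n : ℝ) + 1))))
          Filter.atTop (nhds (‖φ‖ * (2 * 0))) :=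
        (tendsto_one_div_add_atTop_nhds_zero_nat.const_mul 2).const_mul _
      simpa using ENNReal.tendsto_ofReal h1
    obtain ⟨n, hn⟩ := (hlim.eventually (gt_mem_nhds (pos_iff_ne_zero.2 hε))).exists
    exact ⟨P n, (hP n).1, (rl_osc (hP n) φ).trans hn.le⟩
  have hint : ∀ φ : X →L[ℝ] ℝ, Integrable (fun ω => φ (f ω)) μ := fun φ =>
    rl_norm_lintegral (hP 0) φ (hmeas φ).aestronglyMeasurable
  -- the separable subspace
  let S : Set X := Set.range fun q : ℕ × ℕ => f (T q.1 q.2)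
  obtain ⟨Y, hYc, hYs, hZY, Proj, hrange, hfix⟩ := hX (Submodule.span ℝ S).topologicalClosure
    (Submodule.isClosed_topologicalClosure _) (by
      rw [Submodule.topologicalClosure_coe]
      exact ((Set.countable_range _).isSeparable.span (R := ℝ)).closure)
  have hPf : ∀ n i, Proj (f (T n i)) = f (T n i) := fun n i =>
    hfix _ (hZY (Submodule.le_topologicalClosure _ (Submodule.subset_span ⟨(n, i), rfl⟩)))
  have : CompleteSpace Y := hYc.completeSpace_coe
  have : TopologicalSpace.SeparableSpace Y := hYs.separableSpace
  let L : X →L[ℝ] Y := Proj.codRestrict Y fun z => by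
    have : Proj z ∈ Set.range Proj := ⟨z, rfl⟩
    rw [hrange] at this
    exact this
  have hLm : AEStronglyMeasurable (fun ω => L (f ω)) μ :=
    rl_pettis fun φ => hmeas (φ.comp L)
  have hgm : AEStronglyMeasurable (fun ω => Proj (f ω)) μ :=
    Y.subtypeL.continuous.comp_aestronglyMeasurable hLm
  have hgi : Integrable (fun ω => Proj (f ω)) μ := rl_norm_lintegral (hP 0) Proj hgm
  refine ⟨fun ω => Proj (f ω), hgi, fun A hA ε hε => ?_⟩
  obtain ⟨n, hn⟩ : ∃ n : ℕ, (2 * (1 / ((n : ℝ) + 1))) * (2 + ‖Proj‖) < ε := by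
    have h1 : Filter.Tendsto (fun n : ℕ => (2 * (1 / ((n : ℝ) + 1))) * (2 + ‖Proj‖))
        Filter.atTop (nhds ((2 * 0) * (2 + ‖Proj‖))) :=
      (tendsto_one_div_add_atTop_nhds_zero_nat.const_mul 2).mul_const _
    rw [mul_zero, zero_mul] at h1
    exact (h1.eventually (gt_mem_nhds hε)).exists
  have hδ : (0 : ℝ) < 1 / ((n : ℝ) + 1) := by positivity
  set δ : ℝ := 1 / ((n : ℝ) + 1) with hδdef
  obtain ⟨hm, hd, hU⟩ := (hP n).1
  have hPA : IsRLPartition A fun i => P n i ∩ A := by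
    refine ⟨fun i => (hm i).inter hA, fun i j hij => ?_, ?_⟩
    · exact (hd hij).mono Set.inter_subset_left Set.inter_subset_left
    · rw [← Set.iUnion_inter, hU, Set.univ_inter]
  have huniq : ∀ i j ω, ω ∈ P n i → ω ∈ P n j → i = j := by
    intro i j ω hi hj
    by_contra hne
    exact Set.disjoint_left.1 (hd hne) hi hj
  refine ⟨fun i => P n i ∩ A, hPA, fun Γ hΓ hfin R hR => ?_⟩
  have hR' : ∀ j, ∀ i, ∀ ω ∈ Γ j, ω ∈ P n i → R j ∈ P n i := by
    intro j i ω hω hi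
    obtain ⟨k, hk⟩ := hfin j
    rw [huniq i k ω hi (hk hω).1]
    exact (hk (hR j ⟨ω, hω⟩)).1
  have hT' : ∀ j, ∀ i, ∀ ω ∈ P n j ∩ A, ω ∈ P n i → T n j ∈ P n i := by
    intro j i ω hω hi
    rw [huniq i j ω hi hω.1]
    exact hT n j ⟨ω, hω.1⟩
  refine ⟨rl_absConv (hP n) hΓ R hR', lt_of_le_of_lt ?_ hn⟩
  set I := ∫ ω in A, Proj (f ω) ∂μ with hI
  obtain ⟨φ, hφ, hφ'⟩ := exists_dual_vector'' ℝ (RLSum μ f Γ R - I)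
  have k1 := rl_compare hδ (hP n) hΓ R hR' φ (hint φ)
  have k2 := rl_compare hδ (hP n) hPA (T n) hT' φ (hint φ)
  have k3 := rl_compare hδ (hP n) hPA (T n) hT' (φ.comp Proj) (hint _)
  have hsum : Proj (RLSum μ f (fun i => P n i ∩ A) (T n)) =
      RLSum μ f (fun i => P n i ∩ A) (T n) := by
    have habs := rl_absConv (hP n) hPA (T n) hT'
    have h1 : Summable fun i => (μ (P n i ∩ A)).toReal • f (T n i) := by
      refine Summable.of_norm ?_
      simpa [RLSumAbsConv, norm_smul] using habs
    have h2 := h1.hasSum.mapL Proj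
    simp only [map_smul, hPf] at h2
    exact h2.unique h1.hasSum
  have hφI : φ I = ∫ ω in A, (φ.comp Proj) (f ω) ∂μ :=
    (φ.integral_comp_comm hgi.integrableOn).symm
  rw [← hφI, ContinuousLinearMap.comp_apply, hsum] at k3
  have hb1 : ‖φ‖ * (2 * δ) ≤ 2 * δ := by nlinarith
  have hb2 : ‖φ.comp Proj‖ * (2 * δ) ≤ ‖Proj‖ * (2 * δ) := by
    have : ‖φ.comp Proj‖ ≤ ‖φ‖ * ‖Proj‖ := φ.opNorm_comp_le Proj
    have h2 : ‖φ‖ * ‖Proj‖ ≤ 1 * ‖Proj‖ := by gcongr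
    gcongr
    linarith
  have hφ2 : ‖RLSum μ f Γ R - I‖ = φ (RLSum μ f Γ R) - φ I := by
    rw [← map_sub]; exact hφ'.symm
  rw [hφ2]
  rw [abs_le] at k1 k2 k3
  nlinarith [k1.1, k1.2, k2.1, k2.2, k3.1, k3.2]
end
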